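/- Sandwich theorem for guaranteed distortion: R_X(d,0) ≤ H_X(d,0) ≤ R_X(d,0) + log₂(R_X(d,0) + 1) + log₂ e bits. -/

import Mathlib

noncomputable section

/-- `q` is a probability mass function on the finite alphabet `α`. -/
def isPMF {α : Type*} [Fintype α] (q : α → ℝ) : Prop :=
  (∀ a, 0 ≤ q a) ∧ ∑ a, q a = 1

/-- Shannon entropy (in bits) of a pmf on a finite alphabet. -/
def ent {α : Type*} [Fintype α] (q : α → ℝ) : ℝ :=
  ∑ a, -(q a * Real.logb 2 (q a))

/-- Relative entropy (Kullback–Leibler divergence, in bits) between pmfs. -/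
def klDiv {α : Type*} [Fintype α] (μ ν : α → ℝ) : ℝ :=
  ∑ a, μ a * Real.logb 2 (μ a / ν a)

/-- Probability, under `Q`, of the distortion-`D` ball around `x`:
`Q(B_D(x)) = Q {y : df x y ≤ D}`. -/
def probBall {X Y : Type*} [Fintype Y] (Q : Y → ℝ) (df : X → Y → ℝ) (D : ℝ) (x : X) : ℝ :=
  ∑ y, if df x y ≤ D then Q y else 0

/-- Output marginal `P_Y` induced by input pmf `p` and kernel `K`. -/
def marg {X Y : Type*} [Fintype X] [Fintype Y] (p : X → ℝ) (K : X → Y → ℝ) : Y → ℝ :=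
  fun y => ∑ x, p x * K x y

/-- Mutual information (in bits) `I(X;Y)` of the joint law `p ⊗ K`,
written as `E_X [ D(K(X) ‖ P_Y) ]`. -/
def mutInfo {X Y : Type*} [Fintype X] [Fintype Y] (p : X → ℝ) (K : X → Y → ℝ) : ℝ :=
  ∑ x, p x * klDiv (K x) (marg p K)

/-- Binary relative entropy `d(α‖q)` (in bits). -/
def bdiv (a q : ℝ) : ℝ :=
  a * Real.logb 2 (a / q) + (1 - a) * Real.logb 2 ((1 - a) / (1 - q))


lemma aux_cover {X Y : Type*} [Fintype Y] (Q : Y → ℝ) (hQ : isPMF Q)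
    (df : X → Y → ℝ) (D : ℝ) (a : X → ℝ) [Nonempty Y] (S : Finset X)
    (hS : ∀ x ∈ S, 0 < a x ∧ 0 < probBall Q df D x) :
    ∃ (g : ℕ → Y) (w : X → ℕ), (∀ x ∈ S, df x (g (w x)) ≤ D) ∧
      ∑ x ∈ S, a x * ((w x : ℝ) + 1) ≤ ∑ x ∈ S, a x / probBall Q df D x := by
  classical
  induction S using Finset.strongInduction with
  | H S ih =>
  rcases S.eq_empty_or_nonempty with rfl | hne
  · exact ⟨fun _ => Classical.arbitrary Y, fun _ => 0, by simp, by simp⟩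
  have hpos : 0 < ∑ x ∈ S, a x := Finset.sum_pos (fun x hx => (hS x hx).1) hne
  have key : ∃ y, ∑ x ∈ S, a x ≤ ∑ x ∈ S, if df x y ≤ D then a x / probBall Q df D x else 0 := by
    by_contra! hcon
    have h1 : ∑ y, Q y * (∑ x ∈ S, if df x y ≤ D then a x / probBall Q df D x else 0)
        = ∑ x ∈ S, a x := by
      simp_rw [Finset.mul_sum]
      rw [Finset.sum_comm]
      refine Finset.sum_congr rfl fun x hx => ?_
      have hq := (hS x hx).2
      calc _ = ∑ y, (if df x y ≤ D then Q y else 0) * (a x / probBall Q df D x) := by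
            refine Finset.sum_congr rfl fun y _ => ?_
            split_ifs <;> simp
        _ = probBall Q df D x * (a x / probBall Q df D x) := by
            rw [← Finset.sum_mul]; rfl
        _ = a x := by field_simp
    have h2 : ∑ y, Q y * (∑ x ∈ S, if df x y ≤ D then a x / probBall Q df D x else 0)
        < ∑ y, Q y * ∑ x ∈ S, a x := by
      refine Finset.sum_lt_sum (fun y _ => mul_le_mul_of_nonneg_left (hcon y).le (hQ.1 y)) ?_
      have : ∃ y, 0 < Q y := by
        by_contra! h0
        have := Finset.sum_nonpos (s := Finset.univ) (fun y _ => h0 y)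
        have := hQ.2
        linarith
      obtain ⟨y, hy⟩ := this
      exact ⟨y, Finset.mem_univ _, mul_lt_mul_of_pos_left (hcon y) hy⟩
    rw [← Finset.sum_mul, hQ.2, one_mul, h1] at h2
    exact lt_irrefl _ h2
  obtain ⟨y, hy⟩ := key
  have hsub : S.filter (fun x => ¬ df x y ≤ D) ⊂ S := by
    rw [Finset.filter_ssubset]
    by_contra! hcon
    have : (∑ x ∈ S, if df x y ≤ D then a x / probBall Q df D x else 0) = 0 :=
      Finset.sum_eq_zero fun x hx => if_neg (not_le.2 (hcon x hx))
    linarith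
  obtain ⟨g, w, hg, hw⟩ := ih _ hsub (fun x hx => hS x (Finset.mem_filter.1 hx).1)
  refine ⟨fun n => Nat.casesOn n y g, fun x => if df x y ≤ D then 0 else w x + 1, ?_, ?_⟩
  · intro x hx
    by_cases h : df x y ≤ D
    · simp [h]
    · simpa [h] using hg x (Finset.mem_filter.2 ⟨hx, h⟩)
  · rw [Finset.sum_filter, Finset.sum_filter] at hw
    have e1 : ∑ x ∈ S, a x * (((if df x y ≤ D then 0 else w x + 1 : ℕ) : ℝ) + 1)
        = ∑ x ∈ S, a x + ∑ x ∈ S, (if ¬ df x y ≤ D then a x * ((w x : ℝ) + 1) else 0) := by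
      rw [← Finset.sum_add_distrib]
      refine Finset.sum_congr rfl fun x _ => ?_
      by_cases h : df x y ≤ D
      · simp [h]
      · simp [h]; ring
    have e2 : ∑ x ∈ S, a x / probBall Q df D x
        = (∑ x ∈ S, if df x y ≤ D then a x / probBall Q df D x else 0)
          + ∑ x ∈ S, (if ¬ df x y ≤ D then a x / probBall Q df D x else 0) := by
      rw [← Finset.sum_add_distrib]
      refine Finset.sum_congr rfl fun x _ => ?_
      by_cases h : df x y ≤ D <;> simp [h]
    rw [e1, e2]
    linarith

lemma aux_zeta (t : ℝ) (ht : 0 < t) (N : ℕ) :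
    ∑ n ∈ Finset.range (N + 1), ((n : ℝ) + 1) ^ (-(1 + t)) ≤
      1 + (1 / t) * (1 - ((N : ℝ) + 1) ^ (-t)) := by
  induction N with
  | zero => simp
  | succ N ih =>
    rw [Finset.sum_range_succ]
    have hx : (0:ℝ) < (N:ℝ) + 1 := by positivity
    push_cast
    set x : ℝ := (N:ℝ) + 1 with hxdef
    have hx1 : (0:ℝ) < x + 1 := by positivity
    have h1 : (x + 1) ^ (-(1 + t)) = (x + 1) ^ (-t) / (x + 1) := by
      rw [neg_add, Real.rpow_add hx1, Real.rpow_neg_one]; ring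
    have h2 : (x + 1) ^ (-t) * (1 + t / (x + 1)) ≤ x ^ (-t) := by
      have h3 : x ^ (-t) = (x + 1) ^ (-t) * Real.exp (Real.log (x / (x + 1)) * (-t)) := by
        rw [← Real.rpow_def_of_pos (by positivity), ← Real.mul_rpow (by positivity) (by positivity)]
        congr 1
        field_simp
      rw [h3]
      refine mul_le_mul_of_nonneg_left ?_ (by positivity)
      have h4 := Real.log_le_sub_one_of_pos (show 0 < x / (x + 1) by positivity)
      have h5 : x / (x + 1) - 1 = - (1 / (x + 1)) := by field_simp; ring
      have h6 := Real.add_one_le_exp (Real.log (x / (x + 1)) * (-t))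
      have h7 : t / (x + 1) ≤ Real.log (x / (x + 1)) * (-t) := by
        have : t / (x+1) = t * (1 / (x+1)) := by ring
        rw [this]; nlinarith
      linarith
    have h8 : (x + 1) ^ (-t) / (x + 1) ≤ (1 / t) * (x ^ (-t) - (x + 1) ^ (-t)) := by
      rw [one_div, ← div_eq_inv_mul, le_div_iff₀ ht]
      have : (x + 1) ^ (-t) * (1 + t / (x + 1)) = (x+1)^(-t) + (x + 1) ^ (-t) / (x + 1) * t := by
        ring
      linarith
    rw [h1]
    have : (1 / t) * (1 - (x+1) ^ (-t)) =
      (1 / t) * (1 - x ^ (-t)) + (1 / t) * (x ^ (-t) - (x + 1) ^ (-t)) := by ring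
    linarith

lemma aux_gibbs {Y : Type*} [Fintype Y] (P r : Y → ℝ) (hP : isPMF P) (hr : ∀ y, 0 ≤ r y)
    (hr1 : ∑ y, r y ≤ 1) (hac : ∀ y, 0 < P y → 0 < r y) :
    ∑ y, -(P y * Real.log (P y)) ≤ ∑ y, -(P y * Real.log (r y)) := by
  have h : ∀ y, -(P y * Real.log (P y)) ≤ -(P y * Real.log (r y)) + (r y - P y) := by
    intro y
    rcases (hP.1 y).eq_or_lt with h0 | h0
    · rw [← h0]; simpa using hr y
    · have h1 := hac y h0
      have h2 := Real.log_le_sub_one_of_pos (div_pos h1 h0)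
      rw [Real.log_div h1.ne' h0.ne'] at h2
      have h3 := mul_le_mul_of_nonneg_left h2 h0.le
      have h4 : P y * (r y / P y - 1) = r y - P y := by field_simp
      rw [h4] at h3
      linarith
  have := Finset.sum_le_sum (s := Finset.univ) (fun y _ => h y)
  rw [Finset.sum_add_distrib, Finset.sum_sub_distrib, hP.2] at this
  linarith

lemma aux_push {X Y : Type*} [Fintype X] [Fintype Y] [DecidableEq Y] (p : X → ℝ) (f : X → Y)
    (G : Y → ℝ) : ∑ y, (∑ x, if f x = y then p x else 0) * G y = ∑ x, p x * G (f x) := by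
  simp_rw [Finset.sum_mul]
  rw [Finset.sum_comm]
  refine Finset.sum_congr rfl fun x _ => ?_
  rw [Finset.sum_eq_single (f x)]
  · simp
  · intro y _ hy; simp [hy.symm]
  · simp

lemma aux_push_pmf {X Y : Type*} [Fintype X] [Fintype Y] [DecidableEq Y] (p : X → ℝ) (hp : isPMF p)
    (f : X → Y) : isPMF (fun y => ∑ x, if f x = y then p x else 0) := by
  constructor
  · intro y
    exact Finset.sum_nonneg fun x _ => by split_ifs; exacts [hp.1 x, le_rfl]
  · have := aux_push p f (fun _ => 1)
    simpa [hp.2] using this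

lemma aux_main {X Y : Type*} [Fintype X] [Fintype Y] [Nonempty Y] [DecidableEq Y]
    (p : X → ℝ) (df : X → Y → ℝ) (D : ℝ) (hp : isPMF p) (Q : Y → ℝ) (hQ : isPMF Q)
    (hq : ∀ x, 0 < p x → 0 < probBall Q df D x) (L : ℝ) (hL : 0 < L)
    (hLe : ∑ x, p x * -Real.log (probBall Q df D x) ≤ L) :
    ∃ f : X → Y, (∀ x, 0 < p x → df x (f x) ≤ D) ∧
      ∑ y, -((∑ x, if f x = y then p x else 0) *
        Real.log (∑ x, if f x = y then p x else 0)) ≤ L + 1 + Real.log (L + 1) := by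
  classical
  obtain ⟨g, w, hg, hw⟩ := aux_cover Q hQ df D (fun x => p x * probBall Q df D x)
    (Finset.univ.filter (fun x => 0 < p x)) (by
      intro x hx
      have := (Finset.mem_filter.1 hx).2
      exact ⟨mul_pos this (hq x this), hq x this⟩)
  refine ⟨fun x => g (w x), fun x hx => hg x (by simpa using hx), ?_⟩
  have hElog : ∑ x, p x * Real.log ((w x : ℝ) + 1) ≤ L := by
    have hw' : ∑ x, p x * probBall Q df D x * ((w x : ℝ) + 1) ≤ ∑ x, p x := by
      have e1 : ∑ x, p x * probBall Q df D x * ((w x : ℝ) + 1) =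
          ∑ x with 0 < p x, p x * probBall Q df D x * ((w x : ℝ) + 1) := by
        rw [Finset.sum_filter]
        refine Finset.sum_congr rfl fun x _ => ?_
        rcases (hp.1 x).eq_or_lt with h0 | h0
        · simp [← h0]
        · simp [h0]
      have e2 : ∑ x, p x =
          ∑ x with 0 < p x, p x * probBall Q df D x / probBall Q df D x := by
        rw [Finset.sum_filter]
        refine Finset.sum_congr rfl fun x _ => ?_
        rcases (hp.1 x).eq_or_lt with h0 | h0
        · simp [← h0]
        · have := (hq x h0).ne'
          simp [h0, this]
      rw [e1, e2]; exact hw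
    have h : ∀ x, p x * Real.log ((w x : ℝ) + 1) ≤ p x * -Real.log (probBall Q df D x) +
        (p x * probBall Q df D x * ((w x : ℝ) + 1) - p x) := by
      intro x
      rcases (hp.1 x).eq_or_lt with h0 | h0
      · simp [← h0]
      · have hqx := hq x h0
        have hw1 : (0:ℝ) < (w x : ℝ) + 1 := by positivity
        have h2 := Real.log_le_sub_one_of_pos (mul_pos hqx hw1)
        rw [Real.log_mul hqx.ne' hw1.ne'] at h2
        have h3 := mul_le_mul_of_nonneg_left h2 h0.le
        linarith
    have := Finset.sum_le_sum (s := Finset.univ) (fun x _ => h x)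
    rw [Finset.sum_add_distrib, Finset.sum_sub_distrib] at this
    linarith
  obtain ⟨N, hN⟩ : ∃ N : ℕ, ∀ x, w x < N + 1 :=
    ⟨Finset.univ.sup w, fun x => Nat.lt_succ_of_le (Finset.le_sup (Finset.mem_univ x))⟩
  let ρ : ℕ → ℝ := fun n => ((n : ℝ) + 1) ^ (-(1 + 1 / L)) / (L + 1)
  have hρ : ∀ n, 0 < ρ n := fun n => by positivity
  let r : Y → ℝ := fun y => ∑ n ∈ Finset.range (N + 1), if g n = y then ρ n else 0
  have hr : ∀ y, 0 ≤ r y := fun y => Finset.sum_nonneg fun n _ => by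
    split_ifs; exacts [(hρ n).le, le_rfl]
  have hrg : ∀ x, ρ (w x) ≤ r (g (w x)) := by
    intro x
    have := Finset.single_le_sum (f := fun n => if g n = g (w x) then ρ n else 0)
      (s := Finset.range (N + 1)) (fun n _ => by
        split_ifs; exacts [(hρ n).le, le_rfl]) (Finset.mem_range.2 (hN x))
    simpa using this
  have hr1 : ∑ y, r y ≤ 1 := by
    have e : ∑ y, r y = ∑ n ∈ Finset.range (N + 1), ρ n := by
      simp only [r]
      rw [Finset.sum_comm]
      refine Finset.sum_congr rfl fun n _ => ?_
      simp
    rw [e]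
    simp only [ρ]
    rw [← Finset.sum_div, div_le_one (by positivity)]
    have h1 := aux_zeta (1 / L) (by positivity) N
    have h2 : (0:ℝ) < ((N : ℝ) + 1) ^ (-(1 / L)) := by positivity
    rw [one_div_one_div] at h1
    nlinarith
  have hgib := aux_gibbs _ r (aux_push_pmf p hp (fun x => g (w x))) hr hr1 (by
    intro y hy
    obtain ⟨x, _, hx⟩ := Finset.exists_ne_zero_of_sum_ne_zero hy.ne'
    have hxy : g (w x) = y := by
      by_contra h; exact hx (if_neg h)
    rw [← hxy]
    exact (hρ _).trans_le (hrg x))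
  refine hgib.trans ?_
  have e3 := aux_push p (fun x => g (w x)) (fun y => -Real.log (r y))
  simp only [mul_neg] at e3
  rw [e3]
  have h9 : ∀ x, -(p x * Real.log (r (g (w x)))) ≤
      (1 + 1 / L) * (p x * Real.log ((w x : ℝ) + 1)) + p x * Real.log (L + 1) := by
    intro x
    have h1 := Real.log_le_log (hρ _) (hrg x)
    have h2 : Real.log (ρ (w x)) = -(1 + 1 / L) * Real.log ((w x : ℝ) + 1) - Real.log (L + 1) := by
      simp only [ρ]
      rw [Real.log_div (by positivity) (by positivity), Real.log_rpow (by positivity)]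
    have h3 := mul_le_mul_of_nonneg_left h1 (hp.1 x)
    rw [h2] at h3
    linarith
  refine (Finset.sum_le_sum (fun x _ => h9 x)).trans ?_
  rw [Finset.sum_add_distrib, ← Finset.mul_sum, ← Finset.sum_mul, hp.2]
  have h10 := mul_le_mul_of_nonneg_left hElog (show 0 ≤ 1 + 1 / L by positivity)
  have h11 : (1 + 1 / L) * L = L + 1 := by field_simp
  linarith

lemma aux_marg_pmf {X Y : Type*} [Fintype X] [Fintype Y] (p : X → ℝ) (hp : isPMF p)
    (K : X → Y → ℝ) (hK : ∀ x, isPMF (K x)) : isPMF (marg p K) := by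
  constructor
  · intro y
    exact Finset.sum_nonneg fun x _ => mul_nonneg (hp.1 x) ((hK x).1 y)
  · simp only [marg]
    rw [Finset.sum_comm]
    simp_rw [← Finset.mul_sum, (hK _).2, mul_one]
    exact hp.2

lemma aux_marg_ge {X Y : Type*} [Fintype X] [Fintype Y] (p : X → ℝ) (hp : isPMF p)
    (K : X → Y → ℝ) (hK : ∀ x, isPMF (K x)) (x : X) (y : Y) : p x * K x y ≤ marg p K y :=
  Finset.single_le_sum (f := fun x => p x * K x y)
    (fun x _ => mul_nonneg (hp.1 x) ((hK x).1 y)) (Finset.mem_univ x)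

lemma aux_ball_pos {X Y : Type*} [Fintype X] [Fintype Y] (p : X → ℝ) (hp : isPMF p)
    (df : X → Y → ℝ) (D : ℝ)
    (K : X → Y → ℝ) (hK : ∀ x, isPMF (K x))
    (hKD : ∀ x, 0 < p x → ∀ y, ¬ df x y ≤ D → K x y = 0) (x : X) (hx : 0 < p x) :
    0 < probBall (marg p K) df D x := by
  have h1 : ∑ y, p x * K x y ≤ probBall (marg p K) df D x := by
    refine Finset.sum_le_sum fun y _ => ?_
    split_ifs with h
    · exact aux_marg_ge p hp K hK x y
    · rw [hKD x hx y h, mul_zero]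
  rw [← Finset.mul_sum, (hK x).2, mul_one] at h1
  linarith

lemma aux_kl {X Y : Type*} [Fintype X] [Fintype Y] (p : X → ℝ) (hp : isPMF p)
    (df : X → Y → ℝ) (D : ℝ)
    (K : X → Y → ℝ) (hK : ∀ x, isPMF (K x))
    (hKD : ∀ x, 0 < p x → ∀ y, ¬ df x y ≤ D → K x y = 0) (x : X) (hx : 0 < p x) :
    -Real.log (probBall (marg p K) df D x) ≤ Real.log 2 * klDiv (K x) (marg p K) := by
  have hq := aux_ball_pos p hp df D K hK hKD x hx
  set q := probBall (marg p K) df D x with hqdef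
  have e : Real.log 2 * klDiv (K x) (marg p K) =
      ∑ y, K x y * Real.log (K x y / marg p K y) := by
    simp only [klDiv, Real.logb]
    rw [Finset.mul_sum]
    refine Finset.sum_congr rfl fun y _ => ?_
    have : Real.log 2 ≠ 0 := (Real.log_pos one_lt_two).ne'
    field_simp
  rw [e]
  have h : ∀ y, K x y * -Real.log q + (K x y - (if df x y ≤ D then marg p K y else 0) / q) ≤
      K x y * Real.log (K x y / marg p K y) := by
    intro y
    rcases ((hK x).1 y).eq_or_lt with h0 | h0
    · rw [← h0]
      have : 0 ≤ (if df x y ≤ D then marg p K y else 0) / q := by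
        have := (aux_marg_pmf p hp K hK).1 y
        split_ifs <;> positivity
      simpa using this
    · have hd : df x y ≤ D := by
        by_contra h; exact h0.ne' (hKD x hx y h)
      have hm : 0 < marg p K y := (mul_pos hx h0).trans_le (aux_marg_ge p hp K hK x y)
      rw [if_pos hd]
      have h2 := Real.log_le_sub_one_of_pos (div_pos hm (mul_pos hq h0))
      rw [Real.log_div hm.ne' (mul_pos hq h0).ne', Real.log_mul hq.ne' h0.ne'] at h2
      rw [Real.log_div h0.ne' hm.ne']
      have h3 := mul_le_mul_of_nonneg_left h2 h0.le
      have h4 : K x y * (marg p K y / (q * K x y) - 1) = marg p K y / q - K x y := by field_simp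
      rw [h4] at h3
      linarith
  have h5 := Finset.sum_le_sum (s := Finset.univ) (fun y _ => h y)
  rw [Finset.sum_add_distrib, Finset.sum_sub_distrib, ← Finset.sum_mul, ← Finset.sum_div,
    (hK x).2] at h5
  have h6 : (∑ y, if df x y ≤ D then marg p K y else 0) / q = 1 := div_self hq.ne'
  rw [h6] at h5
  linarith

lemma aux_mi {X Y : Type*} [Fintype X] [Fintype Y] (p : X → ℝ) (hp : isPMF p)
    (df : X → Y → ℝ) (D : ℝ)
    (K : X → Y → ℝ) (hK : ∀ x, isPMF (K x))
    (hKD : ∀ x, 0 < p x → ∀ y, ¬ df x y ≤ D → K x y = 0) :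
    ∑ x, p x * -Real.log (probBall (marg p K) df D x) ≤ Real.log 2 * mutInfo p K := by
  simp only [mutInfo]
  rw [Finset.mul_sum]
  refine Finset.sum_le_sum fun x _ => ?_
  rcases (hp.1 x).eq_or_lt with h0 | h0
  · simp [← h0]
  · have := mul_le_mul_of_nonneg_left (aux_kl p hp df D K hK hKD x h0) h0.le
    linarith

lemma aux_mi_nonneg {X Y : Type*} [Fintype X] [Fintype Y] (p : X → ℝ) (hp : isPMF p)
    (df : X → Y → ℝ) (D : ℝ)
    (K : X → Y → ℝ) (hK : ∀ x, isPMF (K x))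
    (hKD : ∀ x, 0 < p x → ∀ y, ¬ df x y ≤ D → K x y = 0) : 0 ≤ mutInfo p K := by
  have h1 := aux_mi p hp df D K hK hKD
  have h2 : 0 ≤ ∑ x, p x * -Real.log (probBall (marg p K) df D x) := by
    refine Finset.sum_nonneg fun x _ => mul_nonneg (hp.1 x) ?_
    have hm := aux_marg_pmf p hp K hK
    have h3 : probBall (marg p K) df D x ≤ 1 := by
      rw [← hm.2]
      refine Finset.sum_le_sum fun y _ => ?_
      split_ifs; exacts [le_rfl, hm.1 y]
    have h4 : 0 ≤ probBall (marg p K) df D x :=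
      Finset.sum_nonneg fun y _ => by split_ifs; exacts [hm.1 y, le_rfl]
    have := Real.log_nonpos h4 h3
    linarith
  exact nonneg_of_mul_nonneg_right (h2.trans h1) (Real.log_pos one_lt_two)

lemma aux_det {X Y : Type*} [Fintype X] [Fintype Y] [DecidableEq Y] (p : X → ℝ)
    (f : X → Y) : mutInfo p (fun x y => if f x = y then 1 else 0) =
      ent (fun y => ∑ x, if f x = y then p x else 0) := by
  have hm : marg p (fun x y => if f x = y then (1:ℝ) else 0) =
      fun y => ∑ x, if f x = y then p x else 0 := by
    funext y; simp [marg]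
  simp only [mutInfo, hm, klDiv, ent]
  have e := aux_push p f (fun y => -Real.logb 2 (∑ x, if f x = y then p x else 0))
  simp only [mul_neg] at e
  rw [e]
  refine Finset.sum_congr rfl fun x _ => ?_
  rw [Finset.sum_eq_single (f x)]
  · simp [Real.logb_inv]
  · intro y _ hy; simp [hy.symm]
  · simp

/-- sandwich theorem for guaranteed distortion:
`R_X(d,0) ≤ H_X(d,0) ≤ R_X(d,0) + log₂(R_X(d,0) + 1) + log₂ e` bits. -/
theorem guaranteed_sandwich {X Y : Type*} [Fintype X] [Fintype Y]
    [Nonempty Y] [DecidableEq Y]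
    (p : X → ℝ) (df : X → Y → ℝ) (D : ℝ) (hp : isPMF p)
    (hball : ∀ x, 0 < p x → ∃ y, df x y ≤ D)
    (Rmin Hmin : ℝ)
    (hRmin : Rmin = sInf {r : ℝ | ∃ K : X → Y → ℝ, (∀ x, isPMF (K x)) ∧
        (∀ x, 0 < p x → ∀ y, ¬ df x y ≤ D → K x y = 0) ∧ r = mutInfo p K})
    (hHmin : Hmin = sInf {r : ℝ | ∃ f : X → Y, (∀ x, 0 < p x → df x (f x) ≤ D) ∧
        r = ent (fun y => ∑ x, if f x = y then p x else 0)}) :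
    Rmin ≤ Hmin ∧
      Hmin ≤ Rmin + Real.logb 2 (Rmin + 1) + Real.logb 2 (Real.exp 1) := by
  classical
  have hc : 0 < Real.log 2 := Real.log_pos one_lt_two
  have hdelta : ∀ f : X → Y, (∀ x, 0 < p x → df x (f x) ≤ D) →
      (∀ x, isPMF (fun y => if f x = y then (1:ℝ) else 0)) ∧
      (∀ x, 0 < p x → ∀ y, ¬ df x y ≤ D → (if f x = y then (1:ℝ) else 0) = 0) := by
    intro f hf
    refine ⟨fun x => ⟨fun y => by dsimp only; split_ifs <;> norm_num, by simp⟩, fun x hx y hy => ?_⟩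
    rw [if_neg]
    rintro rfl
    exact hy (hf x hx)
  have hbR : ∀ r ∈ {r : ℝ | ∃ K : X → Y → ℝ, (∀ x, isPMF (K x)) ∧
        (∀ x, 0 < p x → ∀ y, ¬ df x y ≤ D → K x y = 0) ∧ r = mutInfo p K}, 0 ≤ r := by
    rintro r ⟨K, hK, hKD, rfl⟩
    exact aux_mi_nonneg p hp df D K hK hKD
  obtain ⟨f0, hf0⟩ : ∃ f : X → Y, ∀ x, 0 < p x → df x (f x) ≤ D := by
    have : ∀ x, ∃ y, 0 < p x → df x y ≤ D := by
      intro x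
      by_cases h : 0 < p x
      · obtain ⟨y, hy⟩ := hball x h
        exact ⟨y, fun _ => hy⟩
      · exact ⟨Classical.arbitrary Y, fun h' => absurd h' h⟩
    choose f hf using this
    exact ⟨f, hf⟩
  have hbH : ∀ r ∈ {r : ℝ | ∃ f : X → Y, (∀ x, 0 < p x → df x (f x) ≤ D) ∧
        r = ent (fun y => ∑ x, if f x = y then p x else 0)}, 0 ≤ r := by
    rintro r ⟨f, hf, rfl⟩
    rw [← aux_det]
    exact aux_mi_nonneg p hp df D _ (hdelta f hf).1 (hdelta f hf).2
  constructor
  · rw [hHmin]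
    refine le_csInf ⟨_, f0, hf0, rfl⟩ ?_
    rintro r ⟨f, hf, rfl⟩
    rw [hRmin]
    exact csInf_le ⟨0, hbR⟩ ⟨_, (hdelta f hf).1, (hdelta f hf).2, (aux_det p f).symm⟩
  · have hR0 : 0 ≤ Rmin := by
      rw [hRmin]; exact Real.sInf_nonneg hbR
    have hall : ∀ L, Rmin < L → Hmin ≤ L + Real.logb 2 (L + 1) + Real.logb 2 (Real.exp 1) := by
      intro L hL
      have hL0 : 0 < L := hR0.trans_lt hL
      have hL' := hL
      rw [hRmin] at hL'
      have hne : {r : ℝ | ∃ K : X → Y → ℝ, (∀ x, isPMF (K x)) ∧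
          (∀ x, 0 < p x → ∀ y, ¬ df x y ≤ D → K x y = 0) ∧ r = mutInfo p K}.Nonempty :=
        ⟨_, _, (hdelta f0 hf0).1, (hdelta f0 hf0).2, rfl⟩
      obtain ⟨r, ⟨K, hK, hKD, rfl⟩, hr⟩ := exists_lt_of_csInf_lt hne hL'
      obtain ⟨f, hf, hfe⟩ := aux_main p df D hp (marg p K) (aux_marg_pmf p hp K hK)
        (aux_ball_pos p hp df D K hK hKD) (Real.log 2 * L) (by positivity)
        ((aux_mi p hp df D K hK hKD).trans (mul_le_mul_of_nonneg_left hr.le hc.le))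
      have h1 : Hmin ≤ ent (fun y => ∑ x, if f x = y then p x else 0) := by
        rw [hHmin]; exact csInf_le ⟨0, hbH⟩ ⟨f, hf, rfl⟩
      refine h1.trans ?_
      have h2 : ent (fun y => ∑ x, if f x = y then p x else 0) =
          (∑ y, -((∑ x, if f x = y then p x else 0) *
            Real.log (∑ x, if f x = y then p x else 0))) / Real.log 2 := by
        simp only [ent, Real.logb]
        rw [Finset.sum_div]
        refine Finset.sum_congr rfl fun y _ => ?_
        ring
      rw [h2, div_le_iff₀ hc]
      have h3 : Real.log (Real.log 2 * L + 1) ≤ Real.log (L + 1) := by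
        refine Real.log_le_log (by positivity) ?_
        have : Real.log 2 ≤ 1 := by have := Real.log_two_lt_d9; linarith
        nlinarith
      have h4 : (L + Real.logb 2 (L + 1) + Real.logb 2 (Real.exp 1)) * Real.log 2 =
          Real.log 2 * L + 1 + Real.log (L + 1) := by
        simp only [Real.logb, Real.log_exp]
        field_simp
        ring
      rw [h4]
      linarith
    have hcont : ContinuousAt
        (fun L => L + Real.logb 2 (L + 1) + Real.logb 2 (Real.exp 1)) Rmin := by
      have h1 : Rmin + 1 ≠ 0 := by positivity
      simp only [Real.logb]
      fun_prop (disch := assumption)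
    refine ge_of_tendsto (hcont.tendsto.mono_left (nhdsWithin_le_nhds (s := Set.Ioi Rmin))) ?_
    filter_upwards [self_mem_nhdsWithin] with L hL
    exact hall L hL
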